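/- The program ce = box[X,y] in declare KS(X₁,X₂,v){var u,z; u := X₁(ε↾ε); z := ε; while(v ≠ ε){v := pred(v); z := X₂(z↾u)} return z} in call KS({x → X@x}, {x → X@(X@x)}, y) belongs to SAFE₀ and to SCP_S, and it computes the second-order functional F with F(f)(w) = F_{|w|}(f), where F₀(f) = ε and F_{n+1}(f) = f(f(⟦↾⟧(F_n(f), f(1)))). -/

import Mathlib

set_option maxHeartbeats 1000000

/-! ## Words -/

/-- Words over the alphabet `Σ = {0,1}` (`false` = `0`, `true` = `1`). -/
abbrev Wd := List Bool

/-- `v ⊴ w` : `v` is a subword of `w`. -/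
def Subword (v w : Wd) : Prop := ∃ u u' : Wd, w = u ++ v ++ u'

/-- `v ↾ n` : truncation of `v` to its first `min n |v|` symbols, then padding with a
word of the form `1·0^k` so that the result has length exactly `n+1`. -/
def truncN (v : Wd) (n : ℕ) : Wd :=
  v.take n ++ [true] ++ List.replicate (n - (v.take n).length) false

/-- The semantics `⟦↾⟧(v,w) = v ↾ |w|` of the truncation-padding operator. -/
def truncW (v w : Wd) : Wd := truncN v w.length

/-- `lmin(a,b)` : the length-minimum of two words. -/
def lminW (a b : Wd) : Wd := if a.length < b.length then a else b

/-- Kapron-Steinberg's bounded iterator `I'`. -/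
def Iprime (F : Wd → Wd) (a b c : Wd) : Wd := (fun x => F (lminW x a))^[c.length] b

/-- Encoding of a tuple of words as a single word. -/
def encTuple (ws : List Wd) : Wd :=
  (ws.map (fun w => (w.flatMap fun b => [true, b]) ++ [false, false])).flatten

/-! ## Simple types over `W` and functionals -/

/-- Simple types over the base type `W` of words. -/
inductive Ty where
  | W : Ty
  | arrow : Ty → Ty → Ty
deriving DecidableEq, Repr

/-- Set-theoretic interpretation of a simple type. -/
def Ty.interp : Ty → Type
  | .W => Wd
  | .arrow a b => a.interp → b.interp

/-- The order of a simple type. -/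
def Ty.order : Ty → ℕ
  | .W => 0
  | .arrow a b => max (a.order + 1) b.order

/-- A functional of simple type over `W`. -/
def Functional : Type := Σ T : Ty, T.interp

/-- The type `W → ⋯ → W` (`l` arguments). -/
def ty1 : ℕ → Ty
  | 0 => .W
  | l + 1 => .arrow .W (ty1 l)

/-- The type `(W→W) → ⋯ → (W→W) → W → ⋯ → W` (`k` order-1 arguments, `l` order-0 ones). -/
def ty2 : ℕ → ℕ → Ty
  | 0, l => ty1 l
  | k + 1, l => .arrow (.arrow .W .W) (ty2 k l)

def curry1 : (l : ℕ) → ((Fin l → Wd) → Wd) → (ty1 l).interp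
  | 0, F => F (fun i => i.elim0)
  | l + 1, F => fun w => curry1 l (fun ws => F (Fin.cons w ws))

def curry2 : (k l : ℕ) → ((Fin k → (Wd → Wd)) → (Fin l → Wd) → Wd) → (ty2 k l).interp
  | 0, l, F => curry1 l (F (fun i => i.elim0))
  | k + 1, l, F => fun f => curry2 k l (fun fs => F (Fin.cons f fs))

def curryList : (n : ℕ) → (List Wd → Wd) → (ty1 n).interp :=
  fun n g => curry1 n (fun ws => g (List.ofFn ws))

/-- Types of second-order functionals, in the normalized shape `(W→W)^k → W^l → W`. -/
def IsTy2 (T : Ty) : Prop := ∃ k l, T = ty2 k l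

/-- Restriction of a set of functionals to the second-order ones. -/
def restrict2 (S : Set Functional) : Set Functional := { F ∈ S | IsTy2 F.1 }

/-! ## Simply-typed lambda closure -/

/-- Simply-typed lambda terms (de Bruijn style) with constants from a set `S` of
functionals of simple type over `W`. -/
inductive STLC (S : Set Functional) : List Ty → Ty → Type where
  | const {Γ : List Ty} (F : Functional) (h : F ∈ S) : STLC S Γ F.1
  | var {Γ : List Ty} (i : Fin Γ.length) : STLC S Γ (Γ.get i)
  | abs {Γ : List Ty} {T T' : Ty} : STLC S (T :: Γ) T' → STLC S Γ (.arrow T T')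
  | app {Γ : List Ty} {T T' : Ty} : STLC S Γ (.arrow T T') → STLC S Γ T → STLC S Γ T'

/-- Interpretation of typing contexts. -/
def EnvI : List Ty → Type
  | [] => PUnit
  | T :: Γ => T.interp × EnvI Γ

def lookupE : {Γ : List Ty} → (i : Fin Γ.length) → EnvI Γ → (Γ.get i).interp
  | _ :: _, ⟨0, _⟩, ρ => ρ.1
  | _ :: Γ, ⟨i + 1, h⟩, ρ => lookupE (Γ := Γ) ⟨i, Nat.lt_of_succ_lt_succ h⟩ ρ.2

/-- Denotational semantics of simply-typed lambda terms. -/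
def STLC.denote {S : Set Functional} : {Γ : List Ty} → {T : Ty} → STLC S Γ T → EnvI Γ → T.interp
  | _, _, .const F _, _ => F.2
  | _, _, .var i, ρ => lookupE i ρ
  | _, _, .abs t, ρ => fun v => t.denote (v, ρ)
  | _, _, .app t s, ρ => (t.denote ρ) (s.denote ρ)

/-- `λ(S)` : the set of functionals denoted by closed simply-typed lambda terms with
constants from `S`. -/
def lambdaClosure (S : Set Functional) : Set Functional :=
  fun G => ∃ t : STLC S [] G.1, t.denote PUnit.unit = G.2

/-- `λ(S)₂` : the second-order simply-typed lambda closure of `S`. -/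
def lambdaClosure2 (S : Set Functional) : Set Functional := restrict2 (lambdaClosure S)
/-! ## Operators

A fixed suite of operators, indexed by natural numbers:
`0 = ε`, `1 = pred`, `2 = suc₀`, `3 = suc₁`, `4 = head`, `5 = ==`, `6 = !=`, `7 = lmin`;
every other index denotes the (neutral) constant-`ε` operator. -/

def opArity : ℕ → ℕ
  | 0 => 0
  | 1 => 1 | 2 => 1 | 3 => 1 | 4 => 1
  | 5 => 2 | 6 => 2 | 7 => 2
  | _ => 0

def opSem : ℕ → List Wd → Wd
  | 0, _ => []
  | 1, ws => (ws.getD 0 []).tail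
  | 2, ws => false :: ws.getD 0 []
  | 3, ws => true :: ws.getD 0 []
  | 4, ws => (ws.getD 0 []).take 1
  | 5, ws => [decide (ws.getD 0 [] = ws.getD 1 [])]
  | 6, ws => [decide (ws.getD 0 [] ≠ ws.getD 1 [])]
  | 7, ws => lminW (ws.getD 0 []) (ws.getD 1 [])
  | _, _ => []

/-- A neutral operator: constant (of arity 0), a `{0,1}`-valued predicate, or an operator
whose output is always a subword of one of its inputs. -/
def NeutralOp (o : ℕ) : Prop :=
  opArity o = 0 ∨ (∀ ws, opSem o ws = [false] ∨ opSem o ws = [true]) ∨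
    (∀ ws : List Wd, ws.length = opArity o → ∃ w ∈ ws, Subword (opSem o ws) w)

/-- A positive operator: the output length exceeds the maximal input length by at most a
constant. -/
def PositiveOp (o : ℕ) : Prop :=
  ∃ c : ℕ, ∀ ws : List Wd, (opSem o ws).length ≤ (ws.map List.length).foldr max 0 + c

/-! ## Syntax of the programming language -/

/-- Variables: type-0 variables `v0 x`, type-1 variables `v1 X`, higher-order variables
`vh a`. -/
inductive Var where
  | v0 : ℕ → Var
  | v1 : ℕ → Var
  | vh : ℕ → Var
deriving DecidableEq

/-- Expressions. `oracleCall X e₁ e₂` is the oracle call `X(e₁ ↾ e₂)`. -/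
inductive Expr where
  | var : ℕ → Expr
  | op : ℕ → List Expr → Expr
  | oracleCall : ℕ → Expr → Expr → Expr

/-- Statements. -/
inductive Stmt where
  | skip : Stmt
  | assign : ℕ → Expr → Stmt
  | seq : Stmt → Stmt → Stmt
  | ite : Expr → Stmt → Stmt → Stmt
  | while : Expr → Stmt → Stmt

/-- Procedures `P(X̄, x̄){var ȳ; st return z}`. -/
structure Proc where
  name : ℕ
  oparams : List ℕ
  params : List ℕ
  locals : List ℕ
  body : Stmt
  ret : ℕ

/-- Terms.  A closure `{x → t}` is represented as the pair `(x, t)`. -/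
inductive Tm where
  | var : Var → Tm
  | lam : Var → Tm → Tm
  | app : Tm → Tm → Tm
  | call : ℕ → List (ℕ × Tm) → List Tm → Tm

/-- Programs. -/
inductive Prog where
  | term : Tm → Prog
  | declare : List Proc → Prog → Prog
  | box : Var → Prog → Prog

def mkBoxes (as : List Var) (p : Prog) : Prog := as.foldr .box p

/-- The list of procedures declared in a program. -/
def procsOf : Prog → List Proc
  | .term _ => []
  | .declare ps p => ps ++ procsOf p
  | .box _ p => procsOf p

/-- Substitution `t[s/a]` on terms. -/
def Tm.subst (a : Var) (s : Tm) : Tm → Tm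
  | .var b => if b = a then s else .var b
  | .lam b t => if b = a then .lam b t else .lam b (Tm.subst a s t)
  | .app t1 t2 => .app (Tm.subst a s t1) (Tm.subst a s t2)
  | .call P cs ts =>
      .call P
        (cs.attach.map fun c => (c.1.1, if Var.v0 c.1.1 = a then c.1.2 else Tm.subst a s c.1.2))
        (ts.attach.map fun t => Tm.subst a s t.1)
decreasing_by all_goals
  first
  | (simp only [Tm.lam.sizeOf_spec, Tm.app.sizeOf_spec]; omega)
  | (have h := List.sizeOf_lt_of_mem c.2
     rcases c with ⟨⟨cx, ct⟩, hc⟩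
     simp only [Tm.call.sizeOf_spec, Prod.mk.sizeOf_spec] at *
     omega)
  | (have h := List.sizeOf_lt_of_mem t.2
     simp only [Tm.call.sizeOf_spec]; omega)

/-! ## Program sizes -/

def Expr.size : Expr → ℕ
  | .var _ => 1
  | .op _ args => 1 + (args.attach.map (fun e => e.1.size)).sum
  | .oracleCall _ e1 e2 => 2 + e1.size + e2.size
decreasing_by all_goals
  first
  | (simp only [Expr.oracleCall.sizeOf_spec]; omega)
  | (have h := List.sizeOf_lt_of_mem e.2
     simp only [Expr.op.sizeOf_spec]; omega)

def Stmt.size : Stmt → ℕ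
  | .skip => 1
  | .assign _ e => 2 + e.size
  | .seq s1 s2 => 1 + s1.size + s2.size
  | .ite e s1 s2 => 1 + e.size + s1.size + s2.size
  | .while e s => 1 + e.size + s.size

def Tm.size : Tm → ℕ
  | .var _ => 1
  | .lam _ t => 2 + t.size
  | .app t1 t2 => 1 + t1.size + t2.size
  | .call _ cs ts =>
      2 + (cs.attach.map (fun c => 2 + c.1.2.size)).sum + (ts.attach.map (fun t => t.1.size)).sum
decreasing_by all_goals
  first
  | (simp only [Tm.lam.sizeOf_spec, Tm.app.sizeOf_spec]; omega)
  | (have h := List.sizeOf_lt_of_mem c.2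
     rcases c with ⟨⟨cx, ct⟩, hc⟩
     simp only [Tm.call.sizeOf_spec, Prod.mk.sizeOf_spec] at *
     omega)
  | (have h := List.sizeOf_lt_of_mem t.2
     simp only [Tm.call.sizeOf_spec]; omega)

def Proc.size (p : Proc) : ℕ :=
  2 + p.oparams.length + p.params.length + p.locals.length + p.body.size

/-- The size `|prg|` of a program: the total number of symbols in `prg`. -/
def Prog.size : Prog → ℕ
  | .term t => t.size
  | .declare ps p => 1 + (ps.map Proc.size).sum + p.size
  | .box _ p => 2 + p.size

/-! ## Encoding of programs as words -/

def encNat (n : ℕ) : Wd := List.replicate n true ++ [false]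

def Expr.enc : Expr → Wd
  | .var x => [false, false] ++ encNat x
  | .op o args => [false, true] ++ encNat o ++ encNat args.length
      ++ (args.attach.map (fun e => e.1.enc)).flatten
  | .oracleCall X e1 e2 => [true, false] ++ encNat X ++ e1.enc ++ e2.enc
decreasing_by all_goals
  first
  | (simp only [Expr.oracleCall.sizeOf_spec]; omega)
  | (have h := List.sizeOf_lt_of_mem e.2
     simp only [Expr.op.sizeOf_spec]; omega)

def Stmt.enc : Stmt → Wd
  | .skip => [false, false, false]
  | .assign x e => [false, false, true] ++ encNat x ++ e.enc
  | .seq s1 s2 => [false, true, false] ++ s1.enc ++ s2.enc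
  | .ite e s1 s2 => [false, true, true] ++ e.enc ++ s1.enc ++ s2.enc
  | .while e s => [true, false, false] ++ e.enc ++ s.enc

def Proc.enc (p : Proc) : Wd :=
  encNat p.name ++ encNat p.oparams.length ++ (p.oparams.map encNat).flatten
    ++ encNat p.params.length ++ (p.params.map encNat).flatten
    ++ encNat p.locals.length ++ (p.locals.map encNat).flatten
    ++ p.body.enc ++ encNat p.ret

def Var.enc : Var → Wd
  | .v0 x => [false] ++ encNat x
  | .v1 X => [true, false] ++ encNat X
  | .vh a => [true, true] ++ encNat a

def Tm.enc : Tm → Wd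
  | .var a => [false, false] ++ a.enc
  | .lam a t => [false, true] ++ a.enc ++ t.enc
  | .app t1 t2 => [true, false] ++ t1.enc ++ t2.enc
  | .call P cs ts => [true, true] ++ encNat P ++ encNat cs.length
      ++ (cs.attach.map (fun c => encNat c.1.1 ++ c.1.2.enc)).flatten
      ++ encNat ts.length ++ (ts.attach.map (fun t => t.1.enc)).flatten
decreasing_by all_goals
  first
  | (simp only [Tm.lam.sizeOf_spec, Tm.app.sizeOf_spec]; omega)
  | (have h := List.sizeOf_lt_of_mem c.2
     rcases c with ⟨⟨cx, ct⟩, hc⟩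
     simp only [Tm.call.sizeOf_spec, Prod.mk.sizeOf_spec] at *
     omega)
  | (have h := List.sizeOf_lt_of_mem t.2
     simp only [Tm.call.sizeOf_spec]; omega)

/-- A standard binary encoding of programs. -/
def Prog.enc : Prog → Wd
  | .term t => [false] ++ t.enc
  | .declare ps p => [true, false] ++ encNat ps.length ++ (ps.map Proc.enc).flatten ++ p.enc
  | .box a p => [true, true] ++ a.enc ++ p.enc
/-! ## Operational semantics -/

/-- A store: a pair of finite partial maps assigning words to type-0 variables and
total functions on words to type-1 variables. -/
structure Store where
  w : ℕ → Option Wd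
  o : ℕ → Option (Wd → Wd)

def Store.updW0 (μ : Store) (x : ℕ) (v : Wd) : Store :=
  ⟨fun y => if y = x then some v else μ.w y, μ.o⟩

def Store.updWs (μ : Store) (xs : List ℕ) (vs : List Wd) : Store :=
  (xs.zip vs).foldl (fun m p => m.updW0 p.1 p.2) μ

/-- `a ∈ dom(μ)`. -/
def StoreDefined (μ : Store) : Var → Prop
  | .v0 x => (μ.w x).isSome
  | .v1 X => (μ.o X).isSome
  | .vh _ => False

/-- Continuations: maps from type-1 variables to closures. -/
def Cnt : Type := ℕ → Option (ℕ × Tm)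

/-- The continuation `X̄ ↦ c̄`. -/
def contOf (Xs : List ℕ) (cs : List (ℕ × Tm)) : Cnt :=
  fun X => ((Xs.zip cs).find? (fun q => q.1 == X)).map (·.2)

/-- Values of the call-by-name reduction on terms. -/
inductive IsVal : Tm → Prop
  | var0 (x : ℕ) : IsVal (.var (.v0 x))
  | lam (a : Var) (t : Tm) : IsVal (.lam a t)
  | oapp (X : ℕ) (t : Tm) : IsVal (.app (.var (.v1 X)) t)
  | call (P : ℕ) (cs : List (ℕ × Tm)) (ts : List Tm) : IsVal (.call P cs ts)

/-- Big-step call-by-name reduction `t ↓ v` on terms. -/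
inductive BigStep : Tm → Tm → Prop
  | val {t : Tm} : IsVal t → BigStep t t
  | app {t1 t2 t v : Tm} {a : Var} :
      BigStep t1 (.lam a t) → BigStep (Tm.subst a t2 t) v → BigStep (.app t1 t2) v

mutual
/-- `(σ, μ, φ, e) →exp w`. -/
inductive EvalExpr : List Proc → Store → Cnt → Expr → Wd → Prop
  | var {σ μ φ x v} : μ.w x = some v → EvalExpr σ μ φ (.var x) v
  | op {σ μ φ o args} (ws : List Wd) :
      args.length = opArity o → ws.length = args.length →
      (∀ (i : ℕ) (e : Expr) (w : Wd), args[i]? = some e → ws[i]? = some w → EvalExpr σ μ φ e w) →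
      EvalExpr σ μ φ (.op o args) (opSem o ws)
  | orc {σ μ φ X e1 e2 v u x t w} :
      EvalExpr σ μ φ e1 v → EvalExpr σ μ φ e2 u → φ X = some (x, t) →
      EvalTm σ (μ.updW0 x (truncW v u)) t w →
      EvalExpr σ μ φ (.oracleCall X e1 e2) w

/-- `(σ, μ, φ, st) →st μ'`. -/
inductive EvalStmt : List Proc → Store → Cnt → Stmt → Store → Prop
  | skip {σ μ φ} : EvalStmt σ μ φ .skip μ
  | asg {σ μ φ x e w} : EvalExpr σ μ φ e w → EvalStmt σ μ φ (.assign x e) (μ.updW0 x w)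
  | seq {σ μ φ s1 s2 μ' μ''} :
      EvalStmt σ μ φ s1 μ' → EvalStmt σ μ' φ s2 μ'' → EvalStmt σ μ φ (.seq s1 s2) μ''
  | condT {σ μ φ e s1 s0 μ'} :
      EvalExpr σ μ φ e [true] → EvalStmt σ μ φ s1 μ' → EvalStmt σ μ φ (.ite e s1 s0) μ'
  | condF {σ μ φ e s1 s0 μ'} :
      EvalExpr σ μ φ e [false] → EvalStmt σ μ φ s0 μ' → EvalStmt σ μ φ (.ite e s1 s0) μ'
  | whF {σ μ φ e s} : EvalExpr σ μ φ e [false] → EvalStmt σ μ φ (.while e s) μ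
  | whT {σ μ φ e s μ'} :
      EvalExpr σ μ φ e [true] → EvalStmt σ μ φ (.seq s (.while e s)) μ' →
      EvalStmt σ μ φ (.while e s) μ'

/-- `(σ, μ, t) →env w` for type-0 terms. -/
inductive EvalTm : List Proc → Store → Tm → Wd → Prop
  | tvar {σ μ t x v} : BigStep t (.var (.v0 x)) → μ.w x = some v → EvalTm σ μ t v
  | oa {σ μ t X t1 w f} :
      BigStep t (.app (.var (.v1 X)) t1) → EvalTm σ μ t1 w → μ.o X = some f →
      EvalTm σ μ t (f w)
  | call {σ μ t P cs ts p μ' v} (ws : List Wd) :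
      BigStep t (.call P cs ts) → p ∈ σ → p.name = P →
      cs.length = p.oparams.length → ts.length = p.params.length →
      ws.length = ts.length →
      (∀ (i : ℕ) (t1 : Tm) (w : Wd), ts[i]? = some t1 → ws[i]? = some w → EvalTm σ μ t1 w) →
      EvalStmt σ ((μ.updWs p.params ws).updWs p.locals (List.replicate p.locals.length []))
        (contOf p.oparams cs) p.body μ' →
      μ'.w p.ret = some v →
      EvalTm σ μ t v
end

/-- `(σ, μ, prg) →env w` for programs. -/
inductive EvalProg : List Proc → Store → Prog → Wd → Prop
  | term {σ μ t v} : EvalTm σ μ t v → EvalProg σ μ (.term t) v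
  | dec {σ μ ps prg v} : EvalProg (σ ++ ps) μ prg v → EvalProg σ μ (.declare ps prg) v
  | box {σ μ a prg v} : StoreDefined μ a → EvalProg σ μ prg v → EvalProg σ μ (.box a prg) v

/-- The initial store mapping the boxed variables `X̄` and `x̄` to the inputs. -/
def initStore (Xs xs : List ℕ) (fl : List (Wd → Wd)) (wl : List Wd) : Store :=
  ⟨fun x => (xs.findIdx? (fun y => y == x)).bind (fun i => wl[i]?),
   fun X => (Xs.findIdx? (fun y => y == X)).bind (fun i => fl[i]?)⟩

/-- A closed program in normal form: `box[X̄, x̄] in declare p̄ in t`. -/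
def IsNF (prg : Prog) : Prop :=
  ∃ (Xs xs : List ℕ) (ps : List Proc) (t : Tm), Xs.Nodup ∧ xs.Nodup ∧
    prg = mkBoxes (Xs.map Var.v1 ++ xs.map Var.v0) (.declare ps (.term t))

/-- `prg` is a closed program in normal form computing the total second-order functional
`F : (W→W)^k → W^l → W`. -/
def computesTotal (prg : Prog) (k l : ℕ)
    (F : (Fin k → (Wd → Wd)) → (Fin l → Wd) → Wd) : Prop :=
  ∃ (Xs xs : List ℕ) (ps : List Proc) (t : Tm),
    Xs.length = k ∧ xs.length = l ∧ Xs.Nodup ∧ xs.Nodup ∧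
    prg = mkBoxes (Xs.map Var.v1 ++ xs.map Var.v0) (.declare ps (.term t)) ∧
    ∀ (fs : Fin k → (Wd → Wd)) (ws : Fin l → Wd),
      EvalProg [] (initStore Xs xs (List.ofFn fs) (List.ofFn ws)) prg (F fs ws)

/-- `SN` : the set of terminating programs, i.e. those whose computed second-order
functional is total. -/
def SN : Set Prog := { prg | ∃ k l F, computesTotal prg k l F }

/-- `⟦S⟧` : the set of (total second-order) functionals computed by the programs of `S`. -/
def progFunSet (S : Set Prog) : Set Functional :=
  { G | ∃ prg ∈ S, ∃ k l F, computesTotal prg k l F ∧ G = ⟨ty2 k l, curry2 k l F⟩ }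
/-! ## The tier-based type system -/

/-- Variable typing environments: tiers for type-0 variables. -/
def VEnv : Type := ℕ → Option ℕ

/-- Operator typing environments: `Δ op k_in` is a set of first-order tiers
`k₁ → ⋯ → kₙ → k'`, represented as pairs `(list of argument tiers, result tier)`. -/
def OTE : Type := ℕ → ℕ → Set (List ℕ × ℕ)

/-- Tier-based typing judgments `Γ, Δ ⊢ e : (k, k_in, k_out)` for expressions. -/
inductive TyExpr (Γ : VEnv) (Δ : OTE) : Expr → ℕ × ℕ × ℕ → Prop
  | evar {x k kin kout} : Γ x = some k → TyExpr Γ Δ (.var x) (k, kin, kout)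
  | eop {o args ks k kin kout} :
      (ks, k) ∈ Δ o kin → ks.length = args.length →
      (∀ (i : ℕ) (κ : ℕ) (e : Expr), ks[i]? = some κ → args[i]? = some e →
        TyExpr Γ Δ e (κ, kin, kout)) →
      TyExpr Γ Δ (.op o args) (k, kin, kout)
  | eor {X e1 e2 k kin kout} :
      TyExpr Γ Δ e1 (k, kin, kout) → TyExpr Γ Δ e2 (kout, kin, kout) →
      k < kin → k ≤ kout →
      TyExpr Γ Δ (.oracleCall X e1 e2) (k, kin, kout)

/-- Tier-based typing judgments `Γ, Δ ⊢ st : (k, k_in, k_out)` for statements. -/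
inductive TyStmt (Γ : VEnv) (Δ : OTE) : Stmt → ℕ × ℕ × ℕ → Prop
  | ssk {kin kout} : TyStmt Γ Δ .skip (0, kin, kout)
  | ssub {st k kin kout} : TyStmt Γ Δ st (k, kin, kout) → TyStmt Γ Δ st (k + 1, kin, kout)
  | sseq {s1 s2 k kin kout} :
      TyStmt Γ Δ s1 (k, kin, kout) → TyStmt Γ Δ s2 (k, kin, kout) →
      TyStmt Γ Δ (.seq s1 s2) (k, kin, kout)
  | sasg {x e k1 k2 kin kout} :
      Γ x = some k1 → TyExpr Γ Δ e (k2, kin, kout) → k1 ≤ k2 →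
      TyStmt Γ Δ (.assign x e) (k1, kin, kout)
  | scnd {e s1 s0 k kin kout} :
      TyExpr Γ Δ e (k, kin, kout) → TyStmt Γ Δ s1 (k, kin, kout) →
      TyStmt Γ Δ s0 (k, kin, kout) →
      TyStmt Γ Δ (.ite e s1 s0) (k, kin, kout)
  | swinit {e st k kin} :
      TyExpr Γ Δ e (k, kin, k) → TyStmt Γ Δ st (k, k, k) → 1 ≤ k →
      TyStmt Γ Δ (.while e st) (k, kin, 0)
  | swh {e st k kin kout} :
      TyExpr Γ Δ e (k, kin, kout) → TyStmt Γ Δ st (k, k, kout) → 1 ≤ k → k ≤ kout →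
      TyStmt Γ Δ (.while e st) (k, kin, kout)

/-- Simple typing environments. -/
def TEnv : Type := Var → Option Ty

def TEnv.upd (Γ : TEnv) (a : Var) (T : Ty) : TEnv :=
  fun b => if b = a then some T else Γ b

/-- Procedure typing environments: each procedure is assigned a variable typing
environment and a triplet of tiers. -/
def PEnv : Type := Proc → VEnv × (ℕ × ℕ × ℕ)

/-- Simple typing judgments for terms, with rank bound `R` on the simple types of
lambda-abstractions.  `procs` is the list of procedures in scope. -/
inductive TyTm (R : WithTop ℕ) (Δ : OTE) (procs : List Proc) : TEnv → Tm → Ty → Prop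
  | pvar {ΓW a T} : ΓW a = some T → TyTm R Δ procs ΓW (.var a) T
  | pabs {ΓW a t T T'} :
      TyTm R Δ procs (ΓW.upd a T) t T' → ((Ty.arrow T T').order : WithTop ℕ) ≤ R →
      TyTm R Δ procs ΓW (.lam a t) (.arrow T T')
  | papp {ΓW t1 t2 T T'} :
      TyTm R Δ procs ΓW t1 (.arrow T T') → TyTm R Δ procs ΓW t2 T →
      TyTm R Δ procs ΓW (.app t1 t2) T'
  | pcall {ΓW P cs ts p} :
      p ∈ procs → p.name = P →
      cs.length = p.oparams.length → ts.length = p.params.length →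
      (∀ c ∈ cs, TyTm R Δ procs (ΓW.upd (.v0 c.1) .W) c.2 .W) →
      (∀ t ∈ ts, TyTm R Δ procs ΓW t .W) →
      TyTm R Δ procs ΓW (.call P cs ts) .W

/-- Simple typing judgments for programs. -/
inductive TyProg (R : WithTop ℕ) (Δ : OTE) (Ω : PEnv) : List Proc → TEnv → Prog → Ty → Prop
  | pterm {procs ΓW t T} : TyTm R Δ procs ΓW t T → TyProg R Δ Ω procs ΓW (.term t) T
  | pdec {procs ΓW ps prg T} :
      (∀ p ∈ ps, TyStmt (Ω p).1 Δ p.body (Ω p).2) →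
      TyProg R Δ Ω (procs ++ ps) ΓW prg T →
      TyProg R Δ Ω procs ΓW (.declare ps prg) T
  | pbox {procs ΓW a prg T T'} :
      TyProg R Δ Ω procs (ΓW.upd a T) prg T' →
      TyProg R Δ Ω procs ΓW (.box a prg) (.arrow T T')

/-! ## FP : polynomial time computable functions (via (oracle) Turing machines) -/

/-- Second-order polynomials with `k` function variables and `l` base variables. -/
inductive SOP (k l : ℕ) where
  | const : ℕ → SOP k l
  | var : Fin l → SOP k l
  | app : Fin k → SOP k l → SOP k l
  | add : SOP k l → SOP k l → SOP k l
  | mul : SOP k l → SOP k l → SOP k l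

def SOP.eval {k l : ℕ} : SOP k l → (Fin k → ℕ → ℕ) → (Fin l → ℕ) → ℕ
  | .const n, _, _ => n
  | .var j, _, xs => xs j
  | .app i p, fs, xs => fs i (p.eval fs xs)
  | .add p q, fs, xs => p.eval fs xs + q.eval fs xs
  | .mul p q, fs, xs => p.eval fs xs * q.eval fs xs

/-- The size `|f|` of an oracle `f` : `|f|(n) = max_{|y| ≤ n} |f(y)|`. -/
noncomputable def oSize (f : Wd → Wd) (n : ℕ) : ℕ :=
  sSup { s | ∃ y : Wd, y.length ≤ n ∧ s = (f y).length }

inductive TDir where | left | right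

/-- A Turing machine tape over the alphabet `Option Bool` (`none` = blank), with finitely
many non-blank cells. -/
structure MTape where
  left : List (Option Bool)
  head : Option Bool
  right : List (Option Bool)

def MTape.move : TDir → MTape → MTape
  | .left, ⟨[], h, r⟩ => ⟨[], none, h :: r⟩
  | .left, ⟨a :: l, h, r⟩ => ⟨l, a, h :: r⟩
  | .right, ⟨l, h, []⟩ => ⟨h :: l, none, []⟩
  | .right, ⟨l, h, a :: r⟩ => ⟨h :: l, a, r⟩

def MTape.write (b : Option Bool) (t : MTape) : MTape := ⟨t.left, b, t.right⟩

/-- The word written on the tape from the head rightwards, up to the first blank. -/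
def MTape.wordAt (t : MTape) : Wd :=
  ((t.head :: t.right).takeWhile Option.isSome).filterMap id

/-- Replace the tape content, from the head rightwards, by the word `w`. -/
def MTape.setWord (w : Wd) (t : MTape) : MTape :=
  ⟨t.left, w.head?, w.tail.map some⟩

def MTape.init (w : Wd) : MTape := ⟨[], w.head?, w.tail.map some⟩

inductive OTMAct (k n : ℕ) where
  | halt
  | step (write : Option Bool) (mv : TDir) (next : Fin n)
  | query (i : Fin k) (next : Fin n)

/-- A deterministic oracle Turing machine with `k` oracles; a `query i` step replaces the
tape content at the head by the answer of the `i`-th oracle on it. -/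
structure OTM (k : ℕ) where
  n : ℕ
  δ : Fin (n + 1) → Option Bool → OTMAct k (n + 1)

def OTM.step1 {k : ℕ} (M : OTM k) (fs : Fin k → Wd → Wd)
    (c : Fin (M.n + 1) × MTape) : Fin (M.n + 1) × MTape :=
  match M.δ c.1 c.2.head with
  | .halt => c
  | .step b d q' => (q', (c.2.write b).move d)
  | .query i q' => (q', c.2.setWord (fs i c.2.wordAt))

def OTM.isHalt {k : ℕ} (M : OTM k) (c : Fin (M.n + 1) × MTape) : Prop :=
  M.δ c.1 c.2.head = .halt

/-- `M` on oracles `fs` and input `inp` halts within `T` steps with output `out`. -/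
def OTM.Outputs {k : ℕ} (M : OTM k) (fs : Fin k → Wd → Wd) (inp out : Wd) (T : ℕ) : Prop :=
  ∃ m ≤ T, M.isHalt ((M.step1 fs)^[m] (0, MTape.init inp)) ∧
    ((M.step1 fs)^[m] (0, MTape.init inp)).2.wordAt = out

/-- The empty family of oracles. -/
def noOracle : Fin 0 → Wd → Wd := fun i => i.elim0

/-- The empty family of oracle sizes. -/
def noOSize : Fin 0 → ℕ → ℕ := fun i => i.elim0

/-- `g` (of arity `n`) is polynomial-time computable. -/
def InFP (n : ℕ) (g : List Wd → Wd) : Prop :=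
  ∃ (M : OTM 0) (P : SOP 0 n), ∀ ws : List Wd, ws.length = n →
    M.Outputs noOracle (encTuple ws) (g ws)
      (P.eval noOSize (fun j => (ws.getD j []).length))

/-- The class `FP` of first-order polynomial time computable functions, as a set of
functionals of simple type over `W`. -/
def FPset : Set Functional :=
  { G | ∃ n g, InFP n g ∧ G = ⟨ty1 n, curryList n g⟩ }

/-! ## Safe operator typing environments and safe programs -/

/-- A safe operator typing environment. -/
def SafeOTE (Δ : OTE) : Prop :=
  ∀ o k ks k', (ks, k') ∈ Δ o k →
    (NeutralOp o ∨ PositiveOp o) ∧ InFP (opArity o) (opSem o) ∧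
    ks.length = opArity o ∧
    (∀ ki ∈ ks, k' ≤ ki ∧ ki ≤ k) ∧
    (¬ NeutralOp o → k' < k)

/-- Programs typable (with a second-order type) under the given safe operator typing
environment, with rank bound `R`. -/
def SAFEdet (R : WithTop ℕ) (Δ : OTE) : Set Prog :=
  { prg | ∃ (ΓW : TEnv) (Ω : PEnv) (T : Ty), TyProg R Δ Ω [] ΓW prg T ∧ IsTy2 T }

/-- `SAFE` : the set of safe programs. -/
def SAFE : Set Prog := { prg | ∃ Δ : OTE, SafeOTE Δ ∧ prg ∈ SAFEdet ⊤ Δ }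

/-- `SAFE_r` : the set of safe rank-`r` programs. -/
def SAFEr (r : ℕ) : Set Prog := { prg | ∃ Δ : OTE, SafeOTE Δ ∧ prg ∈ SAFEdet (r : WithTop ℕ) Δ }

/-! ## Safe and terminating procedures -/

/-- The canonical procedure-call term `call P({z → Y₁@z}, …, {z → Y_k@z}, ȳ)` with the
boxed variables `Y_i = v1 i` and `y_j = v0 j`. -/
def ProcCallTm (p : Proc) : Tm :=
  .call p.name
    ((List.range p.oparams.length).map fun i =>
      (p.params.length, Tm.app (.var (.v1 i)) (.var (.v0 p.params.length))))
    ((List.range p.params.length).map fun j => Tm.var (.v0 j))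

def procInitStore (p : Proc) (fl : List (Wd → Wd)) (wl : List Wd) : Store :=
  initStore (List.range p.oparams.length) (List.range p.params.length) fl wl

/-- A terminating procedure. -/
def ProcTerminates (p : Proc) : Prop :=
  ∀ (fl : List (Wd → Wd)) (wl : List Wd),
    fl.length = p.oparams.length → wl.length = p.params.length →
    ∃ v, EvalTm [p] (procInitStore p fl wl) (ProcCallTm p) v

/-- A safe procedure: its body is tier-typable under some safe operator typing
environment. -/
def ProcSafe (p : Proc) : Prop :=
  ∃ (Γ : VEnv) (Δ : OTE) (ks : ℕ × ℕ × ℕ), SafeOTE Δ ∧ TyStmt Γ Δ p.body ks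

/-- The procedure `p` computes the total second-order functional `F`. -/
def ProcComputes (p : Proc) (k l : ℕ)
    (F : (Fin k → (Wd → Wd)) → (Fin l → Wd) → Wd) : Prop :=
  p.oparams.length = k ∧ p.params.length = l ∧
  ∀ (fs : Fin k → (Wd → Wd)) (ws : Fin l → Wd),
    EvalTm [p] (procInitStore p (List.ofFn fs) (List.ofFn ws)) (ProcCallTm p) (F fs ws)

/-- `⟦ST⟧` : the functionals computed by safe and terminating procedures. -/
def STfuns : Set Functional :=
  { G | ∃ p k l F, ProcSafe p ∧ ProcComputes p k l F ∧ G = ⟨ty2 k l, curry2 k l F⟩ }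

/-- The wrapper program `box[Ȳ, ȳ] in declare p in call P({z → Y₁@z}, …, ȳ)`. -/
def wrapperOf (p : Proc) : Prog :=
  mkBoxes ((List.range p.oparams.length).map .v1 ++ (List.range p.params.length).map .v0)
    (.declare [p] (.term (ProcCallTm p)))

/-! ## BFF -/

/-- `BFF` : the basic feasible functionals, i.e. the second-order functionals computable
by an oracle Turing machine in time bounded by a second-order polynomial in the sizes of
the oracles and the lengths of the inputs. -/
def BFF : Set Functional :=
  { G | ∃ (k l : ℕ) (M : OTM k) (P : SOP k l)
          (F : (Fin k → (Wd → Wd)) → (Fin l → Wd) → Wd),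
      (∀ fs xs, M.Outputs fs (encTuple (List.ofFn xs)) (F fs xs)
        (P.eval (fun i => oSize (fs i)) (fun j => (xs j).length))) ∧
      G = ⟨ty2 k l, curry2 k l F⟩ }

/-! ## Polynomial-time decision problems -/

/-- A polynomial-time decidable language of words. -/
def PTimeLang (L : Set Wd) : Prop :=
  ∃ (M : OTM 0) (P : SOP 0 1), ∀ w : Wd,
    (w ∈ L → M.Outputs noOracle w [true] (P.eval noOSize (fun _ => w.length))) ∧
    (w ∉ L → M.Outputs noOracle w [false] (P.eval noOSize (fun _ => w.length)))

/-- A polynomial-time computable function on words. -/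
def PTimeFun (r : Wd → Wd) : Prop :=
  ∃ (M : OTM 0) (P : SOP 0 1), ∀ w : Wd,
    M.Outputs noOracle w (r w) (P.eval noOSize (fun _ => w.length))

/-- A `P`-complete language: in `P`, and every language in `P` reduces to it via a
polynomial-time many-one reduction. -/
def PComplete (L : Set Wd) : Prop :=
  PTimeLang L ∧ ∀ L' : Set Wd, PTimeLang L' →
    ∃ r : Wd → Wd, PTimeFun r ∧ ∀ w, w ∈ L' ↔ r w ∈ L

/-- The language of (encodings of) the programs in `S`. -/
def encLang (S : Set Prog) : Set Wd := { w | ∃ prg ∈ S, w = prg.enc }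

/-- The set `S` of programs is decidable in time `T` (as a function of the program
size). -/
def DecidesInTime (S : Set Prog) (T : ℕ → ℕ) : Prop :=
  ∃ M : OTM 0, ∀ prg : Prog,
    (prg ∈ S → M.Outputs noOracle prg.enc [true] (T prg.size)) ∧
    (prg ∉ S → M.Outputs noOracle prg.enc [false] (T prg.size))
/-! ## Size-change graphs and the criterion `SCP_S` -/

/-- A size-change graph over the type-0 variables: `G y z = some true` is a down-arrow
from `y` to `z`, `some false` a plain arrow, `none` no arrow. -/
def SCG : Type := ℕ → ℕ → Option Bool

instance : Inhabited SCG := ⟨fun _ _ => none⟩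

/-- `op` is decreasing in its `i`-th argument (`strict = true` for strictly
decreasing): fixed choices for the concrete operator suite
(`pred` strictly decreasing in 0, `head` decreasing in 0, `lmin` decreasing in 1). -/
def opDec : ℕ → Option (ℕ × Bool)
  | 1 => some (0, true)
  | 4 => some (0, false)
  | 7 => some (1, false)
  | _ => none

/-- The size-change graph of an assignment `x := e` with (optional) in-arrow to `x`
from `src.1`, a down-arrow when `src.2 = true`; all other variables keep identity
arrows, and `x` receives no other in-arrow. -/
def mkSCG (x : ℕ) (src : Option (ℕ × Bool)) : SCG := fun y z =>
  if z = x then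
    match src with
    | some s => if y = s.1 then some s.2 else none
    | none => none
  else if y = z then some false
  else none

/-- The (source, strictness) of the arrow pointing into the assigned variable, as
determined by the right-hand side expression. -/
def exprSrc : Expr → Option (ℕ × Bool)
  | .var y => some (y, false)
  | .op o args =>
      match opDec o with
      | some (i, d) =>
          match args[i]? with
          | some (.var xi) => some (xi, d)
          | _ => none
      | none => none
  | .oracleCall _ _ _ => none

/-- Finite iteration (Kleene star) of a set of finite sequences of size-change graphs. -/
inductive StarMem (X : Set (List SCG)) : List SCG → Prop
  | nil : StarMem X []
  | cons {a b : List SCG} : a ∈ X → StarMem X b → StarMem X (a ++ b)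

/-- Append a finite sequence in front of an infinite one. -/
def appendInf (a : List SCG) (s : ℕ → SCG) : ℕ → SCG :=
  fun n => if n < a.length then a.getD n default else s (n - a.length)

def flatNthAux : ℕ → (ℕ → List SCG) → ℕ → ℕ → SCG
  | 0, g, i, n => (g i).getD n default
  | fuel + 1, g, i, n =>
      if n < (g i).length then (g i).getD n default
      else flatNthAux fuel g (i + 1) (n - (g i).length)

/-- The infinite concatenation of infinitely many nonempty finite sequences. -/
def flatten (g : ℕ → List SCG) : ℕ → SCG := fun n => flatNthAux (n + 1) g 0 n

/-- `L(st)` : the language of finite (first component) and infinite (second component)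
sequences of size-change graphs associated with a statement. -/
def Ls : Stmt → Set (List SCG) × Set (ℕ → SCG)
  | .skip => ({[]}, ∅)
  | .assign x e => ({[mkSCG x (exprSrc e)]}, ∅)
  | .seq s1 s2 =>
      ({ l | ∃ a ∈ (Ls s1).1, ∃ b ∈ (Ls s2).1, l = a ++ b },
       (Ls s1).2 ∪ { f | ∃ a ∈ (Ls s1).1, ∃ g ∈ (Ls s2).2, f = appendInf a g })
  | .ite _ s1 s2 => ((Ls s1).1 ∪ (Ls s2).1, (Ls s1).2 ∪ (Ls s2).2)
  | .while _ s =>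
      (StarMem (Ls s).1,
       { f | ∃ a, StarMem (Ls s).1 a ∧ ∃ g ∈ (Ls s).2, f = appendInf a g } ∪
       { f | ∃ g : ℕ → List SCG, (∀ n, g n ∈ (Ls s).1 ∧ g n ≠ []) ∧ f = flatten g })

/-- Fan-in freeness of a finite sequence of size-change graphs: each node has in-degree
at most one. -/
def FanInFreeL (gs : List SCG) : Prop :=
  ∀ G ∈ gs, ∀ z y1 y2, (G y1 z).isSome → (G y2 z).isSome → y1 = y2

/-- Fan-in freeness of an infinite sequence of size-change graphs. -/
def FanInFreeI (f : ℕ → SCG) : Prop :=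
  ∀ n z y1 y2, (f n y1 z).isSome → (f n y2 z).isSome → y1 = y2

/-- A down-thread from `x` to `x` in a finite sequence of size-change graphs: a path
spanning every graph of the sequence, starting and ending in `x`, and containing a
down-arrow. -/
def FinDT (x : ℕ) (gs : List SCG) : Prop :=
  ∃ p : ℕ → ℕ, p 0 = x ∧ p gs.length = x ∧
    (∀ i < gs.length, ((gs.getD i default) (p i) (p (i + 1))).isSome) ∧
    (∃ i < gs.length, (gs.getD i default) (p i) (p (i + 1)) = some true)

/-- A down-thread from `x` in an infinite sequence of size-change graphs. -/
def InfDT (x : ℕ) (f : ℕ → SCG) : Prop :=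
  ∃ p : ℕ → ℕ, p 0 = x ∧ (∀ i, (f i (p i) (p (i + 1))).isSome) ∧
    (∃ i, f i (p i) (p (i + 1)) = some true)

open scoped Classical in
/-- Restriction of a size-change graph to a set `V` of variables. -/
noncomputable def SCG.res (V : Set ℕ) (G : SCG) : SCG :=
  fun y z => if y ∈ V ∧ z ∈ V then G y z else none

noncomputable def resList (V : Set ℕ) (gs : List SCG) : List SCG := gs.map (SCG.res V)

noncomputable def resInf (V : Set ℕ) (f : ℕ → SCG) : ℕ → SCG := fun n => (f n).res V

/-- Recognize a while guard of the shape `x ≠ ε`. -/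
def isNeqEps : Expr → Option ℕ
  | .op 6 [.var x, .op 0 []] => some x
  | _ => none

/-- The set of variables occurring in while guards (of the shape `x ≠ ε`). -/
def guardVars : Stmt → Set ℕ
  | .skip => ∅
  | .assign _ _ => ∅
  | .seq s1 s2 => guardVars s1 ∪ guardVars s2
  | .ite _ s1 s2 => guardVars s1 ∪ guardVars s2
  | .while e s =>
      (match isNeqEps e with | some x => {x} | none => ∅) ∪ guardVars s

/-- The simple graph property for the set `V` of variables: every while loop has a guard
of the shape `x ≠ ε` and every (finite or infinite) sequence of size-change graphs of its
body, restricted to `V`, is fan-in free and contains a down-thread from `x` to `x`. -/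
def SGP (V : Set ℕ) : Stmt → Prop
  | .skip => True
  | .assign _ _ => True
  | .seq s1 s2 => SGP V s1 ∧ SGP V s2
  | .ite _ s1 s2 => SGP V s1 ∧ SGP V s2
  | .while e s =>
      (∃ x, isNeqEps e = some x ∧
        (∀ gs ∈ (Ls s).1, FanInFreeL (resList V gs) ∧ FinDT x (resList V gs)) ∧
        (∀ f ∈ (Ls s).2, FanInFreeI (resInf V f) ∧ InfDT x (resInf V f))) ∧
      SGP V s

/-- A procedure satisfying the simple-graph size-change criterion. -/
def ProcSCP (p : Proc) : Prop := SGP (guardVars p.body) p.body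

/-- `SCP_S` : programs all of whose procedures satisfy the simple-graph size-change
criterion. -/
def SCPs : Set Prog := { prg | ∀ p ∈ procsOf prg, ProcSCP p }
/-- The Kapron–Steinberg procedure
`KS(X₁,X₂,v){var u,z; u := X₁(ε↾ε); z := ε; while(v ≠ ε){v := pred(v); z := X₂(z↾u)}
return z}` (with `X₁ = 0`, `X₂ = 1`, `v = 2`, `u = 3`, `z = 4`). -/
def KSproc : Proc :=
  { name := 0, oparams := [0, 1], params := [2], locals := [3, 4],
    body :=
      .seq (.assign 3 (.oracleCall 0 (.op 0 []) (.op 0 [])))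
        (.seq (.assign 4 (.op 0 []))
          (.while (.op 6 [.var 2, .op 0 []])
            (.seq (.assign 2 (.op 1 [.var 2]))
                  (.assign 4 (.oracleCall 1 (.var 4) (.var 3)))))),
    ret := 4 }

/-- The program `ce = box[X,y] in declare KS(…) in
call KS({x → X@x}, {x → X@(X@x)}, y)` (with `X = v1 0`, `y = v0 6`, `x = v0 5`). -/
def ceProg : Prog :=
  mkBoxes [.v1 0, .v0 6]
    (.declare [KSproc]
      (.term (.call 0
        [(5, .app (.var (.v1 0)) (.var (.v0 5))),
         (5, .app (.var (.v1 0)) (.app (.var (.v1 0)) (.var (.v0 5))))]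
        [.var (.v0 6)])))

/-- `F_n(f)` : `F_0(f) = ε` and `F_{n+1}(f) = f(f(⟦↾⟧(F_n(f), f(1))))`. -/
def FceN (f : Wd → Wd) : ℕ → Wd
  | 0 => []
  | n + 1 => f (f (truncW (FceN f n) (f [true])))

/-! ## Running oracle Turing machines -/

/-- The tape with `L` to the left of the head and `R` from the head rightwards. -/
def MTape.split (L : List (Option Bool)) : List (Option Bool) → MTape
  | [] => ⟨L, none, []⟩
  | h :: R => ⟨L, h, R⟩

theorem MTape.init_eq_split (w : Wd) : MTape.init w = MTape.split [] (w.map some) := by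
  cases w <;> rfl

/-- `M` goes from configuration `c` to configuration `c'` in at most `T` steps. -/
def OTM.Runs (M : OTM 0) (c c' : Fin (M.n + 1) × MTape) (T : ℕ) : Prop :=
  ∃ m ≤ T, (M.step1 noOracle)^[m] c = c'

namespace OTM.Runs

variable {M : OTM 0} {c c' c'' : Fin (M.n + 1) × MTape} {T T' : ℕ}

theorem refl : M.Runs c c T := ⟨0, Nat.zero_le _, rfl⟩

theorem trans (h : M.Runs c c' T) (h' : M.Runs c' c'' T') : M.Runs c c'' (T + T') := by
  obtain ⟨m, hm, rfl⟩ := h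
  obtain ⟨m', hm', rfl⟩ := h'
  exact ⟨m' + m, by omega, Function.iterate_add_apply _ _ _ _⟩

theorem mono (h : M.Runs c c' T) (hT : T ≤ T') : M.Runs c c' T' := by
  obtain ⟨m, hm, h⟩ := h
  exact ⟨m, hm.trans hT, h⟩

theorem iterate (m : ℕ) (h : (M.step1 noOracle)^[m] c = c') : M.Runs c c' m := ⟨m, le_rfl, h⟩

theorem outputs {inp out : Wd} (h : M.Runs (0, MTape.init inp) c T) (hc : M.isHalt c)
    (hout : c.2.wordAt = out) : M.Outputs noOracle inp out T := by
  obtain ⟨m, hm, rfl⟩ := h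
  exact ⟨m, hm, hc, hout⟩

/-- A state that copies non-blank symbols and moves left reaches the first blank. -/
theorem sweepLeft (q : Fin (M.n + 1)) (hq : ∀ b, M.δ q (some b) = .step (some b) .left q)
    (L : List (Option Bool)) (l : List Bool) (h : Option Bool) (R : List (Option Bool)) :
    M.Runs (q, MTape.move .left ⟨l.map some ++ none :: L, h, R⟩)
      (q, ⟨L, none, l.reverse.map some ++ h :: R⟩) l.length := by
  induction l generalizing h R with
  | nil => exact refl
  | cons b l ih =>
    have h1 : M.Runs (q, MTape.move .left ⟨(b :: l).map some ++ none :: L, h, R⟩)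
        (q, MTape.move .left ⟨l.map some ++ none :: L, some b, h :: R⟩) 1 := by
      refine iterate 1 ?_
      simp [OTM.step1, MTape.move, MTape.write, hq]
    have h2 := h1.trans (ih (some b) (h :: R))
    simp only [List.reverse_cons, List.map_append, List.append_assoc, List.map_cons, List.map_nil,
      List.cons_append, List.nil_append, List.length_cons] at h2 ⊢
    exact h2.mono (by omega)

end OTM.Runs

/-- The encoding of a word inside a tuple, without its end marker. -/
def encBits (w : Wd) : Wd := w.flatMap fun b => [true, b]

theorem encBits_cons (b : Bool) (w : Wd) : encBits (b :: w) = true :: b :: encBits w := rfl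

theorem length_encBits (w : Wd) : (encBits w).length = 2 * w.length := by
  induction w with
  | nil => rfl
  | cons b w ih => simp only [encBits_cons, List.length_cons, ih]; omega

/-! ## The constant-`ε` operator is in `FP` -/

theorem inFP_eps : InFP (opArity 0) (opSem 0) := by
  refine ⟨⟨0, fun _ _ => .halt⟩, .const 0, fun ws hws => ?_⟩
  obtain rfl : ws = [] := List.length_eq_zero_iff.mp hws
  exact OTM.Runs.outputs OTM.Runs.refl rfl rfl

/-! ## The predecessor operator is in `FP` -/

/-- A machine computing the predecessor: the first encoded bit is erased; then every
tag bit is deleted in turn by shifting the already decoded block one cell to the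
right. -/
def predMachine : OTM 0 where
  n := 9
  δ q s :=
    match q.val, s with
    | 0, some true => .step none .right 1
    | 0, some false => .step none .left 9
    | 1, _ => .step none .right 2
    | 2, some true => .step none .left 3
    | 2, some false => .step none .left 7
    | 3, some b => .step (some b) .left 3
    | 3, none => .step none .right 4
    | 4, none => .step none .right 8
    | 4, some false => .step none .right 5
    | 4, some true => .step none .right 6
    | 5, none => .step (some false) .right 8
    | 5, some false => .step (some false) .right 5
    | 5, some true => .step (some false) .right 6
    | 6, none => .step (some true) .right 8
    | 6, some false => .step (some true) .right 5
    | 6, some true => .step (some true) .right 6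
    | 7, some b => .step (some b) .left 7
    | 7, none => .step none .right 9
    | 8, s => .step s .right 2
    | _, _ => .halt

namespace predMachine

open OTM.Runs

/-- The state in which the machine shifts a block to the right, carrying the bit `c`. -/
def carry : Bool → Fin 10
  | false => 5
  | true => 6

theorem runs_carry (c : Bool) (l : List Bool) (L R : List (Option Bool)) :
    predMachine.Runs (carry c, MTape.split L (l.map some ++ none :: R))
      (8, MTape.split ((c :: l).reverse.map some ++ L) R) (l.length + 1) := by
  induction l generalizing c L with
  | nil => refine iterate 1 ?_; cases c <;> cases R <;> rfl
  | cons d l ih =>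
    have h1 : predMachine.Runs (carry c, MTape.split L ((d :: l).map some ++ none :: R))
        (carry d, MTape.split (some c :: L) (l.map some ++ none :: R)) 1 := by
      refine iterate 1 ?_; cases c <;> cases d <;> cases l <;> rfl
    have h2 := h1.trans (ih d (some c :: L))
    simp only [List.reverse_cons, List.map_append, List.append_assoc, List.map_cons, List.map_nil,
      List.cons_append, List.nil_append, List.length_cons] at h2 ⊢
    exact h2.mono (by omega)

theorem runs_shift (l : List Bool) (L R : List (Option Bool)) :
    predMachine.Runs (4, MTape.split L (l.map some ++ none :: R))
      (8, MTape.split (l.reverse.map some ++ none :: L) R) (l.length + 1) := by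
  cases l with
  | nil => refine iterate 1 ?_; cases R <;> rfl
  | cons c l =>
    have h1 : predMachine.Runs (4, MTape.split L ((c :: l).map some ++ none :: R))
        (carry c, MTape.split (none :: L) (l.map some ++ none :: R)) 1 := by
      refine iterate 1 ?_; cases c <;> cases l <;> rfl
    exact (h1.trans (runs_carry c l (none :: L) R)).mono (by simp only [List.length_cons]; omega)

theorem runs_bit (o : Wd) (b : Bool) (L R : List (Option Bool)) :
    predMachine.Runs
      (2, MTape.split (o.reverse.map some ++ none :: L) (some true :: some b :: R))
      (2, MTape.split ((o ++ [b]).reverse.map some ++ none :: none :: L) R)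
      (2 * o.length + 4) := by
  have h1 : predMachine.Runs
      (2, MTape.split (o.reverse.map some ++ none :: L) (some true :: some b :: R))
      (3, MTape.move .left ⟨o.reverse.map some ++ none :: L, none, some b :: R⟩) 1 :=
    iterate 1 rfl
  have h2 := sweepLeft (M := predMachine) 3 (fun _ => rfl) L o.reverse none (some b :: R)
  have h3 : predMachine.Runs
      (3, ⟨L, none, o.reverse.reverse.map some ++ none :: some b :: R⟩)
      (4, MTape.split (none :: L) (o.map some ++ none :: some b :: R)) 1 := by
    rw [List.reverse_reverse]
    refine iterate 1 ?_; cases o <;> rfl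
  have h4 := runs_shift o (none :: L) (some b :: R)
  have h5 : predMachine.Runs
      (8, MTape.split (o.reverse.map some ++ none :: none :: L) (some b :: R))
      (2, MTape.split ((o ++ [b]).reverse.map some ++ none :: none :: L) R) 1 := by
    rw [List.reverse_append]
    refine iterate 1 ?_; cases R <;> rfl
  exact ((((h1.trans h2).trans h3).trans h4).trans h5).mono
    (by simp only [List.length_reverse]; omega)

theorem runs_end (o : Wd) (L R : List (Option Bool)) :
    predMachine.Runs (2, MTape.split (o.reverse.map some ++ none :: L) (some false :: R))
      (9, MTape.split (none :: L) (o.map some ++ none :: R)) (o.length + 2) := by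
  have h1 : predMachine.Runs (2, MTape.split (o.reverse.map some ++ none :: L) (some false :: R))
      (7, MTape.move .left ⟨o.reverse.map some ++ none :: L, none, R⟩) 1 := iterate 1 rfl
  have h2 := sweepLeft (M := predMachine) 7 (fun _ => rfl) L o.reverse none R
  have h3 : predMachine.Runs (7, ⟨L, none, o.reverse.reverse.map some ++ none :: R⟩)
      (9, MTape.split (none :: L) (o.map some ++ none :: R)) 1 := by
    rw [List.reverse_reverse]
    refine iterate 1 ?_; cases o <;> rfl
  exact ((h1.trans h2).trans h3).mono (by simp only [List.length_reverse]; omega)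

theorem runs_decode (w o : Wd) (L R : List (Option Bool)) :
    ∃ L', predMachine.Runs
      (2, MTape.split (o.reverse.map some ++ none :: L)
        ((encBits w).map some ++ some false :: R))
      (9, MTape.split L' ((o ++ w).map some ++ none :: R))
      (w.length * (2 * (o.length + w.length) + 4) + (o.length + w.length) + 2) := by
  induction w generalizing o L with
  | nil => exact ⟨_, by simpa [encBits] using (runs_end o L R)⟩
  | cons b w ih =>
    obtain ⟨L', h⟩ := ih (o ++ [b]) (none :: L)
    refine ⟨L', ?_⟩
    have h' := (runs_bit o b L ((encBits w).map some ++ some false :: R)).trans h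
    rw [List.append_assoc] at h'
    refine h'.mono ?_
    simp only [List.length_append, List.length_cons, List.length_nil]
    ring_nf
    omega

end predMachine

theorem MTape.wordAt_split (L : List (Option Bool)) (w : Wd) (R : List (Option Bool)) :
    (MTape.split L (w.map some ++ none :: R)).wordAt = w := by
  have h : (MTape.split L (w.map some ++ none :: R)).wordAt
      = ((w.map some ++ none :: R).takeWhile Option.isSome).filterMap id := by
    cases w <;> rfl
  rw [h]
  clear h
  induction w with
  | nil => rfl
  | cons b w ih => simpa using ih

open OTM.Runs in
theorem inFP_pred : InFP (opArity 1) (opSem 1) := by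
  change InFP 1 _
  refine ⟨predMachine, .add (.mul (.var 0) (.add (.mul (.const 2) (.var 0)) (.const 4)))
    (.add (.var 0) (.const 4)), fun ws hws => ?_⟩
  obtain ⟨w, rfl⟩ : ∃ w, ws = [w] := List.length_eq_one_iff.mp hws
  have henc : encTuple [w] = encBits w ++ [false, false] := by simp [encTuple, encBits]
  have hT : SOP.eval (.add (.mul (.var 0) (.add (.mul (.const 2) (.var 0)) (.const 4)))
      (.add (.var 0) (.const 4)) : SOP 0 1) noOSize
      (fun j => (([w] : List Wd).getD j []).length)
      = w.length * (2 * w.length + 4) + (w.length + 4) := rfl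
  rw [hT]
  cases w with
  | nil =>
    exact outputs ((iterate 1 rfl : predMachine.Runs _
      (9, ⟨[], none, [none, some false]⟩) 1).mono (by simp)) rfl rfl
  | cons b w =>
    have h1 : predMachine.Runs (0, MTape.init (encTuple [b :: w]))
        (2, MTape.split [none, none] ((encBits w).map some ++ [some false, some false])) 2 := by
      rw [henc, MTape.init_eq_split, encBits_cons, List.map_append]
      refine iterate 2 ?_
      cases w <;> rfl
    obtain ⟨L', h2⟩ := predMachine.runs_decode w [] [none] [some false]
    refine outputs ((h1.trans h2).mono ?_) rfl (MTape.wordAt_split _ _ _)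
    simp only [List.length_cons, List.length_nil]
    ring_nf
    omega

/-! ## The inequality operator is in `FP` -/

/-- A machine deciding inequality of two words: the encoded bits of the first word are
erased one by one while the matching encoded bits `1b` of the second word are marked by
replacing them with `01`. -/
def neqMachine : OTM 0 where
  n := 23
  δ q s :=
    match q.val, s with
    | 0, some true => .step none .right 1
    | 0, some false => .step (some false) .right 10
    | 1, some false => .step none .right 2
    | 1, some true => .step none .right 3
    | 2, some true => .step (some true) .right 4
    | 3, some true => .step (some true) .right 5
    | 2, some false => .step (some false) .right 6
    | 3, some false => .step (some false) .right 7
    | 4, s => .step s .right 2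
    | 5, s => .step s .right 3
    | 6, s => .step s .right 8
    | 7, s => .step s .right 9
    | 8, some false => .step (some false) .right 11
    | 9, some false => .step (some false) .right 12
    | 8, some true => .step (some true) .right 13
    | 9, some true => .step (some true) .right 14
    | 11, some true => .step (some true) .right 8
    | 12, some true => .step (some true) .right 9
    | 11, some false => .step (some false) .right 20
    | 12, some false => .step (some false) .right 20
    | 13, some false => .step (some true) .left 15
    | 13, some true => .step (some true) .right 20
    | 14, some true => .step (some true) .left 15
    | 14, some false => .step (some false) .right 20
    | 15, _ => .step (some false) .left 16
    | 16, some b => .step (some b) .left 16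
    | 16, none => .step none .right 0
    | 10, s => .step s .right 17
    | 17, some false => .step (some false) .right 18
    | 17, some true => .step (some true) .right 20
    | 18, some true => .step (some true) .right 17
    | 18, some false => .step (some false) .right 21
    | 20, _ => .step (some true) .right 22
    | 21, _ => .step (some false) .right 22
    | 22, _ => .step none .left 23
    | _, _ => .halt

namespace neqMachine

open OTM.Runs

/-- The word `(01)^k` of `k` marked bits. -/
def marks : ℕ → Wd
  | 0 => []
  | k + 1 => false :: true :: marks k

theorem marks_succ (k : ℕ) : marks (k + 1) = marks k ++ [false, true] := by
  induction k with
  | zero => rfl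
  | succ k ih => exact congrArg (fun l => false :: true :: l) ih

theorem length_marks (k : ℕ) : (marks k).length = 2 * k := by
  induction k with
  | zero => rfl
  | succ k ih => simp only [marks, List.length_cons, ih]; omega

/-- The state in which the machine skips the rest of the first word, remembering `a`. -/
def skipWord : Bool → Fin 24
  | false => 2
  | true => 3

/-- The state in which the machine skips the marked bits, remembering `a`. -/
def skipMarks : Bool → Fin 24
  | false => 8
  | true => 9

theorem runs_skipWord (a : Bool) (w : Wd) (L R : List (Option Bool)) :
    neqMachine.Runs
      (skipWord a, MTape.split L ((encBits w ++ [false, false]).map some ++ R))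
      (skipMarks a, MTape.split ((encBits w ++ [false, false]).reverse.map some ++ L) R)
      (2 * w.length + 2) := by
  induction w generalizing L with
  | nil => refine iterate 2 ?_; cases a <;> cases R <;> rfl
  | cons b w ih =>
    have h1 : neqMachine.Runs
        (skipWord a, MTape.split L ((encBits (b :: w) ++ [false, false]).map some ++ R))
        (skipWord a, MTape.split (some b :: some true :: L)
          ((encBits w ++ [false, false]).map some ++ R)) 2 := by
      refine iterate 2 ?_; cases a <;> cases b <;> cases w <;> rfl
    have h2 := h1.trans (ih (some b :: some true :: L))
    simp only [encBits_cons, List.reverse_append, List.reverse_cons, List.map_append,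
      List.append_assoc, List.map_cons, List.map_nil, List.cons_append, List.nil_append,
      List.length_cons] at h2 ⊢
    exact h2.mono (by omega)

theorem runs_marks (q : Fin 24)
    (hq : ∀ L R, neqMachine.Runs (q, MTape.split L (some false :: some true :: R))
      (q, MTape.split (some true :: some false :: L) R) 2)
    (k : ℕ) (L R : List (Option Bool)) :
    neqMachine.Runs (q, MTape.split L ((marks k).map some ++ R))
      (q, MTape.split ((marks k).reverse.map some ++ L) R) (2 * k) := by
  induction k generalizing L with
  | zero => exact refl
  | succ k ih =>
    have h2 := (hq L ((marks k).map some ++ R)).trans (ih (some true :: some false :: L))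
    simp only [marks, List.reverse_cons, List.map_append,
      List.append_assoc, List.map_cons, List.map_nil, List.cons_append, List.nil_append] at h2 ⊢
    exact h2.mono (by omega)

theorem runs_answer (r : Bool) (L R : List (Option Bool)) :
    ∃ c : Fin 24 × MTape, neqMachine.Runs (cond r 20 21, MTape.split L R) c 2 ∧
      neqMachine.isHalt c ∧ c.2.wordAt = [r] := by
  rcases r with _ | _ <;> rcases R with _ | ⟨h, _ | ⟨h', R⟩⟩ <;>
    exact ⟨_, iterate 2 rfl, rfl, rfl⟩

theorem runs_answer_of {c : Fin 24 × MTape} {T : ℕ} (r : Bool) (L R : List (Option Bool))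
    (h : neqMachine.Runs c (cond r 20 21, MTape.split L R) T) :
    ∃ c', neqMachine.Runs c c' (T + 2) ∧ neqMachine.isHalt c' ∧ c'.2.wordAt = [r] := by
  obtain ⟨c', h', hc'⟩ := runs_answer r L R
  exact ⟨c', h.trans h', hc'⟩

/-- The tape content for remaining words `u`, `v` and `k` marked bits. -/
def content (u : Wd) (k : ℕ) (v : Wd) : List (Option Bool) :=
  (encBits u ++ [false, false]).map some ++
    ((marks k).map some ++ (encBits v ++ [false, false]).map some)

theorem runs_nil (k : ℕ) (v : Wd) (L : List (Option Bool)) :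
    ∃ c, neqMachine.Runs (0, MTape.split L (content [] k v)) c (2 * k + 6) ∧
      neqMachine.isHalt c ∧ c.2.wordAt = [decide ([] ≠ v)] := by
  have h1 : neqMachine.Runs (0, MTape.split L (content [] k v))
      (17, MTape.split (some false :: some false :: L)
        ((marks k).map some ++ (encBits v ++ [false, false]).map some)) 2 := by
    refine iterate 2 ?_
    cases k <;> cases v <;> rfl
  have h2 := h1.trans (runs_marks 17 (fun L R => iterate 2 (by cases R <;> rfl)) k _ _)
  cases v with
  | nil =>
    obtain ⟨c, h, hc⟩ := runs_answer_of false _ [] (h2.trans (iterate 2 rfl))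
    exact ⟨c, h.mono (by omega), hc⟩
  | cons b v =>
    obtain ⟨c, h, hc⟩ := runs_answer_of true _
      ((b :: encBits v ++ [false, false]).map some) (h2.trans (iterate 1 rfl))
    refine ⟨c, h.mono (by omega), ?_⟩
    simpa using hc

/-- The tape to the left of the head once the first word and the marks are skipped. -/
def passed (u : Wd) (k : ℕ) : Wd := (marks k).reverse ++ (encBits u ++ [false, false]).reverse

theorem runs_fetch (a : Bool) (u : Wd) (k : ℕ) (v : Wd) (L : List (Option Bool)) :
    neqMachine.Runs (0, MTape.split L (content (a :: u) k v))
      (skipMarks a, MTape.split ((passed u k).map some ++ none :: none :: L)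
        ((encBits v ++ [false, false]).map some)) (2 * u.length + 2 * k + 4) := by
  have h1 : neqMachine.Runs (0, MTape.split L (content (a :: u) k v))
      (skipWord a, MTape.split (none :: none :: L) (content u k v)) 2 := by
    refine iterate 2 ?_
    cases a <;> cases u <;> rfl
  have h2 := h1.trans (runs_skipWord a u _ _)
  have h3 := h2.trans (runs_marks (skipMarks a)
    (fun L R => iterate 2 (by cases a <;> cases R <;> rfl)) k _ _)
  rw [passed, List.map_append, List.append_assoc]
  exact h3.mono (by omega)

theorem runs_match (a : Bool) (u : Wd) (k : ℕ) (v : Wd) (L : List (Option Bool)) :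
    neqMachine.Runs (0, MTape.split L (content (a :: u) k (a :: v)))
      (0, MTape.split (none :: none :: L) (content u (k + 1) v))
      (4 * u.length + 4 * k + 10) := by
  have h1 := runs_fetch a u k (a :: v) L
  have h2 : neqMachine.Runs
      (skipMarks a, MTape.split ((passed u k).map some ++ none :: none :: L)
        ((encBits (a :: v) ++ [false, false]).map some))
      (16, MTape.move .left ⟨(passed u k).map some ++ none :: none :: L, some false,
        some true :: (encBits v ++ [false, false]).map some⟩) 3 := by
    refine iterate 3 ?_
    cases a <;> rfl
  have h3 := sweepLeft (M := neqMachine) 16 (fun _ => rfl) (none :: L) (passed u k)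
    (some false) (some true :: (encBits v ++ [false, false]).map some)
  have hcontent : (passed u k).reverse.map some ++
      some false :: some true :: (encBits v ++ [false, false]).map some
      = content u (k + 1) v := by
    simp [passed, content, marks_succ]
  rw [hcontent] at h3
  have h4 : neqMachine.Runs (16, ⟨none :: L, none, content u (k + 1) v⟩)
      (0, MTape.split (none :: none :: L) (content u (k + 1) v)) 1 := by
    refine iterate 1 ?_
    cases u <;> rfl
  have hlen : (passed u k).length = 2 * k + (2 * u.length + 2) := by
    simp [passed, length_marks, length_encBits]
  exact (((h1.trans h2).trans h3).trans h4).mono (by omega)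

theorem runs_compare (u v : Wd) (k : ℕ) (L : List (Option Bool)) :
    ∃ c, neqMachine.Runs (0, MTape.split L (content u k v)) c
        (u.length * (4 * (u.length + k) + 10) + 2 * k + 2 * u.length + 8) ∧
      neqMachine.isHalt c ∧ c.2.wordAt = [decide (u ≠ v)] := by
  induction u generalizing v k L with
  | nil =>
    obtain ⟨c, h, hc⟩ := runs_nil k v L
    exact ⟨c, h.mono (by simp only [List.length_nil]; omega), hc⟩
  | cons a u ih =>
    cases v with
    | nil =>
      obtain ⟨c, h, hc⟩ := runs_answer_of true
        (some false :: some false :: ((passed u k).map some ++ none :: none :: L)) []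
        ((runs_fetch a u k [] L).trans (iterate 2 (by cases a <;> rfl)))
      refine ⟨c, h.mono ?_, by simpa using hc⟩
      simp only [List.length_cons]
      nlinarith
    | cons b v =>
      by_cases hab : a = b
      · subst hab
        obtain ⟨c, h, hc⟩ := ih v (k + 1) (none :: none :: L)
        refine ⟨c, ((runs_match a u k v L).trans h).mono ?_, by simpa using hc⟩
        simp only [List.length_cons]
        nlinarith
      · obtain ⟨c, h, hc⟩ := runs_answer_of true
          (some b :: some true :: ((passed u k).map some ++ none :: none :: L))
          ((encBits v ++ [false, false]).map some)
          ((runs_fetch a u k (b :: v) L).trans (iterate 2 (by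
            cases a <;> cases b <;> first | exact absurd rfl hab | (cases v <;> rfl))))
        refine ⟨c, h.mono ?_, by simpa [hab] using hc⟩
        simp only [List.length_cons]
        nlinarith

end neqMachine

theorem inFP_neq : InFP (opArity 6) (opSem 6) := by
  change InFP 2 _
  refine ⟨neqMachine, .add (.mul (.var 0) (.add (.mul (.const 4) (.var 0)) (.const 10)))
    (.add (.mul (.const 2) (.var 0)) (.const 8)), fun ws hws => ?_⟩
  obtain ⟨u, v, rfl⟩ : ∃ u v, ws = [u, v] := List.length_eq_two.mp hws
  obtain ⟨c, h, hc, hout⟩ := neqMachine.runs_compare u v 0 []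
  have henc : MTape.init (encTuple [u, v]) = MTape.split [] (neqMachine.content u 0 v) := by
    rw [MTape.init_eq_split]
    simp [encTuple, neqMachine.content, neqMachine.marks, encBits]
  rw [← henc] at h
  refine OTM.Runs.outputs (h.mono ?_) hc hout
  change _ ≤ u.length * (4 * u.length + 10) + (2 * u.length + 8)
  simp only [add_zero, mul_zero]
  omega

/-! ## Safety -/

/-- A safe operator typing environment for `ε`, `pred` and `≠`. -/
def ceOTE : OTE := fun o k =>
  { p | (o = 0 ∧ p = ([], 1)) ∨ (o = 1 ∧ p = ([1], 1) ∧ 1 ≤ k) ∨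
    (o = 6 ∧ p = ([1, 1], 1) ∧ 1 ≤ k) }

theorem neutralOp_pred : NeutralOp 1 := by
  refine Or.inr (Or.inr fun ws hws => ?_)
  obtain ⟨w, rfl⟩ : ∃ w, ws = [w] := List.length_eq_one_iff.mp hws
  refine ⟨w, by simp, w.take 1, [], ?_⟩
  cases w <;> simp [opSem]

theorem neutralOp_neq : NeutralOp 6 := by
  refine Or.inr (Or.inl fun ws => ?_)
  by_cases h : ws.getD 0 [] = ws.getD 1 []
  · left; simp only [opSem, h]; simp
  · right; simp only [opSem, ne_eq, h]; simp

theorem safeOTE_ceOTE : SafeOTE ceOTE := by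
  rintro o k ks k' (⟨rfl, h⟩ | ⟨rfl, h, hk⟩ | ⟨rfl, h, hk⟩) <;>
    obtain ⟨rfl, rfl⟩ := Prod.mk.inj h
  · have hN : NeutralOp 0 := Or.inl rfl
    exact ⟨Or.inl hN, inFP_eps, rfl, by simp, fun h => absurd hN h⟩
  · exact ⟨Or.inl neutralOp_pred, inFP_pred, rfl, by simpa using hk,
      fun h => absurd neutralOp_pred h⟩
  · exact ⟨Or.inl neutralOp_neq, inFP_neq, rfl, by simpa using hk,
      fun h => absurd neutralOp_neq h⟩

/-- Tiers of the variables of the procedure `KS`. -/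
def ksVEnv : VEnv := fun x => if x = 4 then some 0 else some 1

theorem tyExpr_eps (kin kout : ℕ) : TyExpr ksVEnv ceOTE (.op 0 []) (1, kin, kout) :=
  .eop (ks := []) (Or.inl ⟨rfl, rfl⟩) rfl (by simp)

theorem tyStmt_KSproc : TyStmt ksVEnv ceOTE KSproc.body (1, 2, 1) := by
  refine .sseq (.sasg (k2 := 1) rfl (.eor (tyExpr_eps 2 1) (tyExpr_eps 2 1) (by norm_num) le_rfl)
    le_rfl) (.sseq (.ssub (.sasg (k2 := 1) rfl (tyExpr_eps 2 1) (Nat.zero_le _)))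
      (.swh (.eop (ks := [1, 1]) (Or.inr (Or.inr ⟨rfl, rfl, by norm_num⟩)) rfl ?_)
        (.sseq (.sasg (k2 := 1) rfl
            (.eop (ks := [1]) (Or.inr (Or.inl ⟨rfl, rfl, le_rfl⟩)) rfl ?_) le_rfl)
          (.ssub (.sasg (k2 := 0) rfl (.eor (.evar rfl) (.evar rfl) (by norm_num) (Nat.zero_le _))
            le_rfl)))
        le_rfl le_rfl))
  · rintro (_ | _ | i) κ e hκ he <;> simp at hκ he <;> subst hκ he
    · exact .evar rfl
    · exact tyExpr_eps 2 1
  · rintro (_ | i) κ e hκ he <;> simp at hκ he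
    subst hκ he
    exact .evar rfl

theorem ceProg_mem_SAFEr : ceProg ∈ SAFEr 0 := by
  refine ⟨ceOTE, safeOTE_ceOTE, fun _ => none, fun _ => (ksVEnv, (1, 2, 1)),
    .arrow (.arrow .W .W) (.arrow .W .W), ?_, 1, 1, rfl⟩
  refine .pbox (.pbox (.pdec ?_ (.pterm (.pcall (p := KSproc) ?_ rfl rfl rfl ?_ ?_))))
  · intro p hp
    obtain rfl := List.mem_singleton.mp hp
    exact tyStmt_KSproc
  · simp
  · intro c hc
    simp only [List.mem_cons, List.not_mem_nil, or_false] at hc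
    rcases hc with rfl | rfl
    · exact .papp (T := .W) (.pvar rfl) (.pvar rfl)
    · exact .papp (T := .W) (.pvar rfl) (.papp (T := .W) (.pvar rfl) (.pvar rfl))
  · intro t ht
    obtain rfl := List.mem_singleton.mp ht
    exact .pvar rfl

/-! ## The size-change criterion -/

theorem procSCP_KSproc : ProcSCP KSproc := by
  have hV : guardVars KSproc.body = {2} := by simp [guardVars, KSproc, isNeqEps]
  rw [ProcSCP, hV]
  refine ⟨trivial, trivial, ⟨2, rfl, ?_, ?_⟩, trivial, trivial⟩
  · rintro gs ⟨a, rfl, b, rfl, rfl⟩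
    have h2 : ((2 : ℕ) ∈ ({2} : Set ℕ)) := rfl
    refine ⟨?_, fun _ => 2, rfl, rfl, ?_, 0, ?_, ?_⟩
    · intro G hG z y1 y2 h h'
      obtain ⟨G', -, rfl⟩ := List.mem_map.mp hG
      unfold SCG.res at h h'
      split_ifs at h h' with h1 h3
      · exact h1.1.trans h3.1.symm
      · simp at h'
      · simp at h
      · simp at h
    · intro i hi
      change i < 2 at hi
      interval_cases i <;> simp [resList, SCG.res, mkSCG, exprSrc, opDec]
    · exact Nat.zero_lt_two
    · simp [resList, SCG.res, mkSCG, exprSrc, opDec]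
  · rintro f (hf | ⟨a, -, g, hg, -⟩)
    · exact hf.elim
    · exact hg.elim

theorem ceProg_mem_SCPs : ceProg ∈ SCPs := by
  intro p hp
  obtain rfl : p = KSproc := by simpa [ceProg, mkBoxes, procsOf] using hp
  exact procSCP_KSproc

/-! ## Semantics -/

section Semantics

variable {σ : List Proc} {μ : Store} {φ : Cnt}

theorem exprEval_eps : EvalExpr σ μ φ (.op 0 []) [] :=
  .op (o := 0) [] rfl rfl (by simp)

theorem exprEval_pred {x : ℕ} {v : Wd} (hx : μ.w x = some v) :
    EvalExpr σ μ φ (.op 1 [.var x]) v.tail := by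
  refine .op (o := 1) [v] rfl rfl ?_
  rintro (_ | i) e w he hw <;> simp at he hw
  subst he hw
  exact .var hx

theorem exprEval_neq_eps {x : ℕ} {v : Wd} (hx : μ.w x = some v) :
    EvalExpr σ μ φ (.op 6 [.var x, .op 0 []]) [decide (v ≠ [])] := by
  refine .op (o := 6) [v, []] rfl rfl ?_
  rintro (_ | _ | i) e w he hw <;> simp at he hw <;> subst he hw
  · exact .var hx
  · exact exprEval_eps

theorem evalTm_app {X : ℕ} {t : Tm} {w : Wd} {f : Wd → Wd} (hX : μ.o X = some f)
    (ht : EvalTm σ μ t w) : EvalTm σ μ (.app (.var (.v1 X)) t) (f w) :=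
  .oa (.val (.oapp X t)) ht hX

theorem evalTm_var {x : ℕ} {w : Wd} (hx : μ.w x = some w) : EvalTm σ μ (.var (.v0 x)) w :=
  .tvar (.val (.var0 x)) hx

/-- The loop of `KS` iterates its second closure `|v|` times. -/
theorem evalStmt_loop (f : Wd → Wd)
    (hφ : φ 1 = some (5, .app (.var (.v1 0)) (.app (.var (.v1 0)) (.var (.v0 5)))))
    (v : Wd) (n : ℕ) (hv : μ.w 2 = some v) (hu : μ.w 3 = some (f [true]))
    (hz : μ.w 4 = some (FceN f n)) (hf : μ.o 0 = some f) :
    ∃ μ', EvalStmt σ μ φ (.while (.op 6 [.var 2, .op 0 []])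
        (.seq (.assign 2 (.op 1 [.var 2])) (.assign 4 (.oracleCall 1 (.var 4) (.var 3))))) μ' ∧
      μ'.w 4 = some (FceN f (n + v.length)) := by
  induction v generalizing n μ with
  | nil => exact ⟨μ, .whF (by simpa using exprEval_neq_eps (σ := σ) (φ := φ) hv), by simpa using hz⟩
  | cons b v ih =>
    obtain ⟨μ', h, h'⟩ := ih (μ := (μ.updW0 2 v).updW0 4 (FceN f (n + 1))) (n + 1)
      rfl hu rfl hf
    refine ⟨μ', .whT (by simpa using exprEval_neq_eps (σ := σ) (φ := φ) hv)
      (.seq (.seq (.asg (exprEval_pred hv)) (.asg ?_)) h), ?_⟩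
    · exact .orc (.var hz) (.var hu) hφ (evalTm_app hf (evalTm_app hf (evalTm_var rfl)))
    · rw [h', List.length_cons]
      congr 2
      omega

end Semantics

theorem computesTotal_ceProg :
    computesTotal ceProg 1 1 (fun fs ws => FceN (fs 0) (ws 0).length) := by
  refine ⟨[0], [6], _, _, rfl, rfl, by simp, by simp, rfl, fun fs ws => ?_⟩
  have hX : (initStore [0] [6] (List.ofFn fs) (List.ofFn ws)).o 0 = some (fs 0) := by
    simp [initStore]
  have hy : (initStore [0] [6] (List.ofFn fs) (List.ofFn ws)).w 6 = some (ws 0) := by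
    simp [initStore]
  generalize initStore [0] [6] (List.ofFn fs) (List.ofFn ws) = μ at hX hy
  refine .box (by simp [StoreDefined, hX]) (.box (by simp [StoreDefined, hy]) (.dec (.term ?_)))
  obtain ⟨μ', h, h'⟩ := evalStmt_loop (σ := [KSproc])
    (μ := ((((μ.updW0 2 (ws 0)).updW0 3 []).updW0 4 []).updW0 3 (fs 0 [true])).updW0 4 [])
    (φ := contOf [0, 1] [(5, .app (.var (.v1 0)) (.var (.v0 5))),
      (5, .app (.var (.v1 0)) (.app (.var (.v1 0)) (.var (.v0 5))))])
    (fs 0) rfl (ws 0) 0 rfl rfl rfl hX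
  rw [Nat.zero_add] at h'
  refine .call (p := KSproc) [ws 0] (.val (.call _ _ _)) (by simp) rfl rfl rfl rfl ?_
    (.seq (.asg (.orc exprEval_eps exprEval_eps rfl
      (evalTm_app hX (evalTm_var rfl)))) (.seq (.asg exprEval_eps) h)) h'
  rintro (_ | i) t w ht hw <;> simp at ht hw
  subst ht hw
  exact evalTm_var hy

/-- The program `ce` belongs to `SAFE₀` and to `SCP_S`, and computes
the second-order functional `F` with `F(f)(w) = F_{|w|}(f)`. -/
theorem ceProg_props :
    ceProg ∈ SAFEr 0 ∧ ceProg ∈ SCPs ∧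
    computesTotal ceProg 1 1 (fun fs ws => FceN (fs 0) (ws 0).length) := by
  exact ⟨ceProg_mem_SAFEr, ceProg_mem_SCPs, computesTotal_ceProg⟩
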